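/- arXiv:2405.05630 — 3 statements merged into one kernel-verified Lean document; each statement's English description precedes it below -/
import Mathlib

section
/- The density p*(τ) := p(τ)‖g(τ)‖/Z is a probability density on T with respect to λ, it is admissible, and the importance-sampling estimator with behavioral density p* satisfies ∫_{{p*>0}} p*(τ) ‖(p(τ)/p*(τ)) g(τ)‖² dλ(τ) = Z²; consequently its variance equals Var_{p*} = Z² − ‖μ‖². -/
open MeasureTheory

/-- The density `p*(τ) = p(τ)‖g(τ)‖ / Z` is a probability density on `T`
w.r.t. `ν`, it is admissible (its zero set is contained, up to null sets, in the zero set of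
`p‖g‖`), the importance-sampling estimator with behavioral density `p*` has second moment
`∫_{p*>0} p* ‖(p/p*) g‖² = Z²`, and consequently its variance equals `Z² − ‖μ‖²`. -/
theorem optimal_behavioral_density
    {T : Type*} [MeasurableSpace T] (ν : Measure T) [SigmaFinite ν]
    {d : ℕ} (hd : 1 ≤ d)
    (p : T → ℝ) (g : T → EuclideanSpace ℝ (Fin d))
    (hp_meas : Measurable p) (hp_nonneg : ∀ τ, 0 ≤ p τ)
    (hp_int : Integrable p ν) (hp_one : ∫ τ, p τ ∂ν = 1)
    (hg_meas : Measurable g)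
    (hpg_int : Integrable (fun τ => p τ * ‖g τ‖) ν)
    (Z : ℝ) (hZ : Z = ∫ τ, p τ * ‖g τ‖ ∂ν) (hZ_pos : 0 < Z)
    (μ : EuclideanSpace ℝ (Fin d))
    (hμ_int : Integrable (fun τ => p τ • g τ) ν)
    (hμ : μ = ∫ τ, p τ • g τ ∂ν)
    (pstar : T → ℝ) (hpstar : ∀ τ, pstar τ = p τ * ‖g τ‖ / Z) :
    -- `p*` is a probability density:
    (∀ τ, 0 ≤ pstar τ) ∧ (∫ τ, pstar τ ∂ν = 1) ∧
    -- `p*` is admissible: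
    (∀ᵐ τ ∂ν, pstar τ = 0 → p τ * ‖g τ‖ = 0) ∧
    -- second moment of the IS estimator with behavioral density `p*`:
    (∫ τ in {τ | 0 < pstar τ}, pstar τ * ‖(p τ / pstar τ) • g τ‖ ^ 2 ∂ν = Z ^ 2) ∧
    -- its variance equals `Z² − ‖μ‖²`:
    (∫ τ in {τ | 0 < pstar τ}, pstar τ * ‖(p τ / pstar τ) • g τ - μ‖ ^ 2 ∂ν
      = Z ^ 2 - ‖μ‖ ^ 2) := by
  have hZ_ne : Z ≠ 0 := hZ_pos.ne'
  have hpstar_nonneg : ∀ τ, 0 ≤ pstar τ := fun τ => by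
    rw [hpstar]
    exact div_nonneg (mul_nonneg (hp_nonneg τ) (norm_nonneg _)) hZ_pos.le
  have hpstar_eq : pstar = fun τ => p τ * ‖g τ‖ / Z := funext hpstar
  have hpstar_int : Integrable pstar ν := hpstar_eq ▸ hpg_int.div_const Z
  have hpstar_one : ∫ τ, pstar τ ∂ν = 1 := by
    rw [hpstar_eq, integral_div, ← hZ, div_self hZ_ne]
  have hzero : ∀ τ, pstar τ = 0 → p τ * ‖g τ‖ = 0 := fun τ h => by
    rw [hpstar, div_eq_zero_iff] at h
    exact h.resolve_right hZ_ne
  have hpstar_off : ∀ τ, τ ∉ {τ | 0 < pstar τ} → pstar τ = 0 := fun τ h =>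
    le_antisymm (not_lt.mp h) (hpstar_nonneg τ)
  have hsmul_off : ∀ τ, τ ∉ {τ | 0 < pstar τ} → p τ • g τ = 0 := fun τ h => by
    rw [← norm_eq_zero, norm_smul, Real.norm_of_nonneg (hp_nonneg τ)]
    exact hzero τ (hpstar_off τ h)
  have hpstar_meas : Measurable pstar := by
    rw [hpstar_eq]
    fun_prop
  have hS : MeasurableSet {τ | 0 < pstar τ} := measurableSet_lt measurable_const hpstar_meas
  have hnorm : ∀ τ, 0 < pstar τ → ‖(p τ / pstar τ) • g τ‖ = Z := fun τ h => by
    rw [norm_smul, Real.norm_of_nonneg (div_nonneg (hp_nonneg τ) h.le), div_mul_eq_mul_div,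
      div_eq_iff h.ne', hpstar, mul_div_cancel₀ _ hZ_ne]
  have hinner_int : Integrable (fun τ => inner ℝ μ (p τ • g τ)) ν := hμ_int.const_inner μ
  have hinner : ∫ τ, inner ℝ μ (p τ • g τ) ∂ν = ‖μ‖ ^ 2 := by
    rw [integral_inner hμ_int, ← hμ, real_inner_self_eq_norm_sq]
  refine ⟨hpstar_nonneg, hpstar_one, .of_forall hzero, ?_, ?_⟩
  · have hcongr : ∀ τ ∈ {τ | 0 < pstar τ},
        pstar τ * ‖(p τ / pstar τ) • g τ‖ ^ 2 = pstar τ * Z ^ 2 := fun τ h => by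
      rw [hnorm τ h]
    rw [setIntegral_congr_fun hS hcongr, setIntegral_eq_integral_of_forall_compl_eq_zero
      (fun τ h => by rw [hpstar_off τ h, zero_mul]), integral_mul_const, hpstar_one, one_mul]
  · have hcongr : ∀ τ ∈ {τ | 0 < pstar τ},
        pstar τ * ‖(p τ / pstar τ) • g τ - μ‖ ^ 2 =
          pstar τ * (Z ^ 2 + ‖μ‖ ^ 2) - 2 * inner ℝ μ (p τ • g τ) := fun τ h => by
      have hne : pstar τ ≠ 0 := ne_of_gt h
      rw [norm_sub_sq_real, hnorm τ h, real_inner_comm, inner_smul_right, inner_smul_right]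
      field_simp
      ring
    rw [setIntegral_congr_fun hS hcongr, setIntegral_eq_integral_of_forall_compl_eq_zero
      (fun τ h => by rw [hpstar_off τ h, hsmul_off τ h, inner_zero_right]; ring),
      integral_sub (hpstar_int.mul_const _) (hinner_int.const_mul 2), integral_mul_const,
      integral_const_mul, hpstar_one, hinner]
    ring
end

section
/- Let q be an admissible probability density on T with ∫_{{q>0}} (p²/q)‖g‖² dλ < ∞. Then the excess second moment of the importance-sampling estimator under q over that under p* equals Z² χ²(p*‖q); consequently Var_q = (Z² − ‖μ‖²) + Z² χ²(p*‖q), and the variance reduction over on-policy (Monte Carlo) estimation satisfies Var_p^{on} − Var_q = Var_p[‖g‖] − Z² χ²(p*‖q), where Var_p^{on} := ∫ p‖g‖² dλ − ‖μ‖² and Var_p[‖g‖] := ∫ p‖g‖² dλ − Z². -/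
open MeasureTheory

/-- Term-by-term integration of the expansion `a - 2 b + k c` of a square. -/
lemma setIntegral_expand_sq {T : Type*} [MeasurableSpace T] {ν : Measure T} {s : Set T}
    (hs : MeasurableSet s) {f a b c : T → ℝ} {k : ℝ}
    (ha : IntegrableOn a s ν) (hb : IntegrableOn b s ν) (hc : IntegrableOn c s ν)
    (h : ∀ τ ∈ s, f τ = a τ - 2 * b τ + k * c τ) :
    ∫ τ in s, f τ ∂ν
      = ∫ τ in s, a τ ∂ν - 2 * ∫ τ in s, b τ ∂ν + k * ∫ τ in s, c τ ∂ν := by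
  have hab : IntegrableOn (fun τ => a τ - 2 * b τ) s ν := ha.sub (hb.const_mul 2)
  rw [setIntegral_congr_fun hs h, integral_add hab (hc.const_mul k),
    integral_sub ha (hb.const_mul 2), integral_const_mul, integral_const_mul]

/-- For an admissible behavioral density `q` with finite second moment
`∫_{q>0} (p²/q)‖g‖² < ∞`, the excess second moment of the importance-sampling estimator
under `q` over that under `p*` equals `Z² χ²(p*‖q)`; consequently
`Var_q = (Z² − ‖μ‖²) + Z² χ²(p*‖q)` and
`Var_p^on − Var_q = Var_p[‖g‖] − Z² χ²(p*‖q)`, where `Var_p^on = ∫ p‖g‖² − ‖μ‖²` and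
`Var_p[‖g‖] = ∫ p‖g‖² − Z²`.  Here `χ²(u‖v) = ∫_{v>0} (u−v)²/v`. -/
theorem variance_reduction_chi_square
    {T : Type*} [MeasurableSpace T] (ν : Measure T) [SigmaFinite ν]
    {d : ℕ} (hd : 1 ≤ d)
    (p : T → ℝ) (g : T → EuclideanSpace ℝ (Fin d))
    (hp_meas : Measurable p) (hp_nonneg : ∀ τ, 0 ≤ p τ)
    (hp_int : Integrable p ν) (hp_one : ∫ τ, p τ ∂ν = 1)
    (hg_meas : Measurable g)
    (hpg_int : Integrable (fun τ => p τ * ‖g τ‖) ν)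
    (hpg2_int : Integrable (fun τ => p τ * ‖g τ‖ ^ 2) ν)
    (Z : ℝ) (hZ : Z = ∫ τ, p τ * ‖g τ‖ ∂ν) (hZ_pos : 0 < Z)
    (μ : EuclideanSpace ℝ (Fin d))
    (hμ_int : Integrable (fun τ => p τ • g τ) ν)
    (hμ : μ = ∫ τ, p τ • g τ ∂ν)
    (pstar : T → ℝ) (hpstar : ∀ τ, pstar τ = p τ * ‖g τ‖ / Z)
    -- an admissible behavioral probability density `q` with finite second moment:
    (q : T → ℝ) (hq_meas : Measurable q) (hq_nonneg : ∀ τ, 0 ≤ q τ)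
    (hq_int : Integrable q ν) (hq_one : ∫ τ, q τ ∂ν = 1)
    (hq_adm : ∀ᵐ τ ∂ν, q τ = 0 → p τ * ‖g τ‖ = 0)
    (hsnd_int : IntegrableOn (fun τ => (p τ) ^ 2 / q τ * ‖g τ‖ ^ 2) {τ | 0 < q τ} ν) :
    -- the excess second moment over that under `p*` equals `Z² χ²(p*‖q)`:
    (∫ τ in {τ | 0 < q τ}, (p τ) ^ 2 / q τ * ‖g τ‖ ^ 2 ∂ν) - Z ^ 2
      = Z ^ 2 * ∫ τ in {τ | 0 < q τ}, (pstar τ - q τ) ^ 2 / q τ ∂ν ∧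
    -- consequently `Var_q = (Z² − ‖μ‖²) + Z² χ²(p*‖q)`:
    (∫ τ in {τ | 0 < q τ}, q τ * ‖(p τ / q τ) • g τ - μ‖ ^ 2 ∂ν)
      = (Z ^ 2 - ‖μ‖ ^ 2)
        + Z ^ 2 * ∫ τ in {τ | 0 < q τ}, (pstar τ - q τ) ^ 2 / q τ ∂ν ∧
    -- and `Var_p^on − Var_q = Var_p[‖g‖] − Z² χ²(p*‖q)`:
    ((∫ τ, p τ * ‖g τ‖ ^ 2 ∂ν) - ‖μ‖ ^ 2)
        - (∫ τ in {τ | 0 < q τ}, q τ * ‖(p τ / q τ) • g τ - μ‖ ^ 2 ∂ν)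
      = ((∫ τ, p τ * ‖g τ‖ ^ 2 ∂ν) - Z ^ 2)
        - Z ^ 2 * ∫ τ in {τ | 0 < q τ}, (pstar τ - q τ) ^ 2 / q τ ∂ν := by
  have hs : MeasurableSet {τ | 0 < q τ} := measurableSet_lt measurable_const hq_meas
  have hq_zero : ∀ τ, τ ∉ {τ | 0 < q τ} → q τ = 0 := fun τ hτ =>
    le_antisymm (not_lt.mp hτ) (hq_nonneg τ)
  have hq_mass : ∫ τ in {τ | 0 < q τ}, q τ ∂ν = 1 := by
    rw [setIntegral_eq_integral_of_forall_compl_eq_zero hq_zero, hq_one]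
  have hZ_set : ∫ τ in {τ | 0 < q τ}, p τ * ‖g τ‖ ∂ν = Z := by
    rw [hZ]
    refine setIntegral_eq_integral_of_ae_compl_eq_zero ?_
    filter_upwards [hq_adm] with τ h hτ using h (hq_zero τ hτ)
  have hμ_set : ∫ τ in {τ | 0 < q τ}, inner ℝ μ (p τ • g τ) ∂ν = ‖μ‖ ^ 2 := by
    rw [integral_inner hμ_int.integrableOn, ← real_inner_self_eq_norm_sq]
    congr 1
    rw [hμ]
    refine setIntegral_eq_integral_of_ae_compl_eq_zero ?_
    filter_upwards [hq_adm] with τ h hτ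
    simpa using h (hq_zero τ hτ)
  have h_chi : (∫ τ in {τ | 0 < q τ}, (p τ) ^ 2 / q τ * ‖g τ‖ ^ 2 ∂ν) - Z ^ 2
      = Z ^ 2 * ∫ τ in {τ | 0 < q τ}, (pstar τ - q τ) ^ 2 / q τ ∂ν := by
    rw [← integral_const_mul, setIntegral_expand_sq hs hsnd_int
      (hpg_int.integrableOn.const_mul Z) hq_int.integrableOn (k := Z ^ 2)
      (f := fun τ => Z ^ 2 * ((pstar τ - q τ) ^ 2 / q τ)),
      integral_const_mul, hZ_set, hq_mass]
    · ring
    · intro τ hτ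
      have hqτ : q τ ≠ 0 := ne_of_gt hτ
      rw [hpstar]
      field_simp
      ring
  have h_var : (∫ τ in {τ | 0 < q τ}, q τ * ‖(p τ / q τ) • g τ - μ‖ ^ 2 ∂ν)
      = (∫ τ in {τ | 0 < q τ}, (p τ) ^ 2 / q τ * ‖g τ‖ ^ 2 ∂ν) - ‖μ‖ ^ 2 := by
    rw [setIntegral_expand_sq hs hsnd_int (hμ_int.integrableOn.const_inner μ)
      hq_int.integrableOn (k := ‖μ‖ ^ 2), hμ_set, hq_mass]
    · ring
    · intro τ hτ
      have hqτ : q τ ≠ 0 := ne_of_gt hτ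
      rw [norm_sub_sq_real, norm_smul, mul_pow, Real.norm_eq_abs, sq_abs, real_inner_smul_left,
        real_inner_smul_right, real_inner_comm]
      field_simp
  refine ⟨h_chi, ?_, ?_⟩ <;> linarith
end

section
/- Let q̃ be a probability density on T with KL(p*‖q̃) ≤ ε for some ε ∈ [0,1], assume G := ess sup_{{p>0}} ‖g(τ)‖ < ∞ and ∫ p‖g‖² dλ < ∞, set β := √(ε/(2−ε)) ∈ [0,1] and φ := β p + (1−β) q̃ (when ε = 0 take β = 0). Then the variance reduction from using the defensive mixture φ in place of p satisfies Var_p^{on} − Var_φ ≥ Var_p[‖g‖] − 4Z²(2−ε) − 4ZGε − 4Z(Z+G)√(ε(2−ε)) ≥ Var_p[‖g‖] − 8Z² − 4Z(Z+2G)√ε, where Var_p^{on} := ∫ p‖g‖² dλ − ‖μ‖² and Var_p[‖g‖] := ∫ p‖g‖² dλ − Z². -/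
open MeasureTheory

/-- The integrand `a log (a / q) - a + q` of the generalized relative entropy is nonnegative. -/
lemma mul_log_div_sub_add_nonneg {a q : ℝ} (ha : 0 ≤ a) (hq : 0 ≤ q) (h : q = 0 → a = 0) :
    0 ≤ a * Real.log (a / q) - a + q := by
  rcases ha.eq_or_lt with rfl | ha
  · simpa using hq
  have hq' : 0 < q := hq.lt_of_ne fun h0 => ha.ne' (h h0.symm)
  have h1 := Real.one_sub_inv_le_log_of_pos (div_pos ha hq')
  have h2 : a * (1 - (a / q)⁻¹) = a - q := by field_simp
  nlinarith [mul_le_mul_of_nonneg_left h1 ha.le]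

/-- Where the ratio `a / q` exceeds `4`, the relative entropy integrand controls `a`. -/
lemma le_three_mul_mul_log_div_sub_add {a q : ℝ} (hq : 0 ≤ q) (h : q = 0 → a = 0)
    (haq : 4 * q < a) : a ≤ 3 * (a * Real.log (a / q) - a + q) := by
  have ha : 0 < a := by linarith
  have hq' : 0 < q := hq.lt_of_ne fun h0 => ha.ne' (h h0.symm)
  have h4 : Real.log 4 ≤ Real.log (a / q) :=
    Real.log_le_log (by norm_num) (by rw [le_div_iff₀ hq']; exact haq.le)
  have h2 : Real.log 4 = 2 * Real.log 2 := by
    rw [show (4 : ℝ) = 2 ^ 2 by norm_num, Real.log_pow]; norm_num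
  have h3 := Real.log_two_gt_d9
  nlinarith [mul_le_mul_of_nonneg_left (show (4 / 3 : ℝ) ≤ Real.log (a / q) by linarith) ha.le]

/-- Weighted harmonic-arithmetic mean bound for the density ratio against a mixture. -/
lemma sq_div_mixture_le {a p q r K β : ℝ} (ha : 0 ≤ a) (hp : 0 ≤ p) (hq : 0 ≤ q) (hr : 0 ≤ r)
    (hK : 0 ≤ K) (hβ0 : 0 ≤ β) (hβ1 : β ≤ 1) (hap : a ≤ r * p) (haq : a ≤ K * q) :
    a ^ 2 / (β * p + (1 - β) * q) ≤ (β * r + (1 - β) * K) * a := by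
  have hγ : 0 ≤ 1 - β := by linarith
  have hφ : 0 ≤ β * p + (1 - β) * q := by positivity
  rcases hφ.eq_or_lt with h0 | hφ
  · rw [← h0, div_zero]; positivity
  rw [div_le_iff₀ hφ]
  have hcross : 2 * a ≤ r * q + K * p := by
    refine abs_le_of_sq_le_sq' ?_ (by positivity) |>.2
    nlinarith [sq_nonneg (r * q - K * p), mul_le_mul hap haq ha (by positivity)]
  have hmain : a ≤ (β * r + (1 - β) * K) * (β * p + (1 - β) * q) := by
    nlinarith [mul_le_mul_of_nonneg_left hcross (mul_nonneg hβ0 hγ),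
      mul_le_mul_of_nonneg_left hap (mul_nonneg hβ0 hβ0),
      mul_le_mul_of_nonneg_left haq (mul_nonneg hγ hγ)]
  nlinarith [mul_le_mul_of_nonneg_left hmain ha]

/-- The density ratio against a mixture is bounded through its defensive component. -/
lemma sq_div_mixture_le_of_pos {a p q r β : ℝ} (ha : 0 ≤ a) (hp : 0 ≤ p) (hq : 0 ≤ q)
    (hr : 0 ≤ r) (hβ0 : 0 < β) (hβ1 : β ≤ 1) (hap : a ≤ r * p) :
    a ^ 2 / (β * p + (1 - β) * q) ≤ r / β * a := by
  have hγ : 0 ≤ 1 - β := by linarith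
  have hφ : 0 ≤ β * p + (1 - β) * q := by positivity
  rcases hφ.eq_or_lt with h0 | hφ
  · rw [← h0, div_zero]; positivity
  rw [div_le_iff₀ hφ]
  have hmain : a ≤ r / β * (β * p + (1 - β) * q) := by
    have h1 : r / β * (β * p + (1 - β) * q) = r * p + r / β * ((1 - β) * q) := by field_simp
    have h2 : 0 ≤ r / β * ((1 - β) * q) := by positivity
    linarith
  nlinarith [mul_le_mul_of_nonneg_left hmain ha]

/-- The relative entropy integrand is integrable, with integral the relative entropy. -/
lemma integral_mul_log_div_sub_add {T : Type*} [MeasurableSpace T] {ν : Measure T} {a q : T → ℝ}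
    (ha_nonneg : ∀ τ, 0 ≤ a τ) (ha : Integrable a ν) (hq : Integrable q ν)
    (hKL : IntegrableOn (fun τ => a τ * Real.log (a τ / q τ)) {τ | 0 < a τ} ν) :
    Integrable (fun τ => a τ * Real.log (a τ / q τ) - a τ + q τ) ν ∧
      ∫ τ, (a τ * Real.log (a τ / q τ) - a τ + q τ) ∂ν =
        (∫ τ in {τ | 0 < a τ}, a τ * Real.log (a τ / q τ) ∂ν) - ∫ τ, a τ ∂ν + ∫ τ, q τ ∂ν := by
  have hzero : ∀ τ, τ ∉ {τ | 0 < a τ} → a τ * Real.log (a τ / q τ) = 0 := fun τ hτ => by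
    rw [le_antisymm (not_lt.1 hτ) (ha_nonneg τ), zero_mul]
  have hint : Integrable (fun τ => a τ * Real.log (a τ / q τ)) ν := by
    rwa [integrableOn_iff_integrable_of_support_subset] at hKL
    intro τ hτ
    by_contra h
    exact hτ (hzero τ h)
  refine ⟨(hint.sub ha).add hq, ?_⟩
  rw [setIntegral_eq_integral_of_forall_compl_eq_zero hzero, ← integral_sub hint ha]
  exact integral_add (hint.sub ha) hq

/-- The variance of the importance-sampling estimator is its second moment minus `‖μ‖²`. -/
lemma setIntegral_importance_variance {T E : Type*} [MeasurableSpace T] {ν : Measure T}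
    [NormedAddCommGroup E] [InnerProductSpace ℝ E] [CompleteSpace E]
    {p φ : T → ℝ} {g : T → E} {μ : E} (hφ_meas : Measurable φ) (hφ_nonneg : ∀ τ, 0 ≤ φ τ)
    (hφ_int : Integrable φ ν) (hφ_one : ∫ τ, φ τ ∂ν = 1)
    (hμ_int : Integrable (fun τ => p τ • g τ) ν) (hμ : μ = ∫ τ, p τ • g τ ∂ν)
    (hsupp : ∀ᵐ τ ∂ν, φ τ = 0 → p τ • g τ = 0)
    (hW : Integrable (fun τ => (p τ * ‖g τ‖) ^ 2 / φ τ) ν) :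
    ∫ τ in {τ | 0 < φ τ}, φ τ * ‖(p τ / φ τ) • g τ - μ‖ ^ 2 ∂ν =
      ∫ τ, (p τ * ‖g τ‖) ^ 2 / φ τ ∂ν - ‖μ‖ ^ 2 := by
  rw [← integral_indicator (measurableSet_lt measurable_const hφ_meas)]
  have hinner : Integrable (fun τ => inner ℝ μ (p τ • g τ)) ν := hμ_int.const_inner μ
  have hae : ({τ | 0 < φ τ}.indicator fun τ => φ τ * ‖(p τ / φ τ) • g τ - μ‖ ^ 2) =ᵐ[ν]
      fun τ => (p τ * ‖g τ‖) ^ 2 / φ τ - 2 * inner ℝ μ (p τ • g τ) + ‖μ‖ ^ 2 * φ τ := by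
    filter_upwards [hsupp] with τ hτ
    rcases (hφ_nonneg τ).eq_or_lt with h0 | hpos
    · simp [← h0, hτ h0.symm]
    · rw [Set.indicator_of_mem (by exact hpos), norm_sub_sq_real, norm_smul, real_inner_comm,
        real_inner_smul_right, real_inner_smul_right, mul_pow, Real.norm_eq_abs, sq_abs]
      field_simp
  have hsub : Integrable
      (fun τ => (p τ * ‖g τ‖) ^ 2 / φ τ - 2 * inner ℝ μ (p τ • g τ)) ν :=
    hW.sub (hinner.const_mul 2)
  rw [integral_congr_ae hae, integral_add hsub (hφ_int.const_mul _),
    integral_sub hW (hinner.const_mul 2), integral_const_mul, integral_const_mul,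
    integral_inner hμ_int, ← hμ, hφ_one, real_inner_self_eq_norm_sq]
  ring

/-- If `a ≤ r p` and `KL(a‖q) ≤ ε = β² (2 - ε)`, then the second moment of the density ratio
against the mixture `β p + (1 - β) q` is bounded. -/
lemma integral_sq_div_mixture_le {T : Type*} [MeasurableSpace T] {ν : Measure T}
    {a p q : T → ℝ} {r β ε : ℝ} (hp_nonneg : ∀ τ, 0 ≤ p τ) (hp_meas : Measurable p)
    (ha_nonneg : ∀ τ, 0 ≤ a τ) (ha_meas : Measurable a)
    (ha : Integrable a ν) (ha_one : ∫ τ, a τ ∂ν = 1)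
    (hq_nonneg : ∀ τ, 0 ≤ q τ) (hq_meas : Measurable q)
    (hq : Integrable q ν) (hq_one : ∫ τ, q τ ∂ν = 1)
    (hr : 0 ≤ r) (hap : ∀ᵐ τ ∂ν, a τ ≤ r * p τ) (hAC : ∀ᵐ τ ∂ν, q τ = 0 → a τ = 0)
    (hKL : IntegrableOn (fun τ => a τ * Real.log (a τ / q τ)) {τ | 0 < a τ} ν)
    (hKL_le : (∫ τ in {τ | 0 < a τ}, a τ * Real.log (a τ / q τ) ∂ν) ≤ ε)
    (hβ0 : 0 ≤ β) (hβ1 : β ≤ 1) (hβε : ε = β ^ 2 * (2 - ε)) :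
    Integrable (fun τ => a τ ^ 2 / (β * p τ + (1 - β) * q τ)) ν ∧
      ∫ τ, a τ ^ 2 / (β * p τ + (1 - β) * q τ) ∂ν ≤
        β * r + (1 - β) * 4 + 3 * r * β * (2 - ε) := by
  obtain ⟨hh_int, hh⟩ := integral_mul_log_div_sub_add ha_nonneg ha hq hKL
  set h : T → ℝ := fun τ => a τ * Real.log (a τ / q τ) - a τ + q τ with hh_def
  have hh_le : ∫ τ, h τ ∂ν ≤ ε := by rw [hh]; linarith
  have hh_nonneg : 0 ≤ᵐ[ν] h := by
    filter_upwards [hAC] with τ hτ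
    exact mul_log_div_sub_add_nonneg (ha_nonneg τ) (hq_nonneg τ) hτ
  have hγ : 0 ≤ 1 - β := by linarith
  have hbound : ∀ᵐ τ ∂ν, a τ ^ 2 / (β * p τ + (1 - β) * q τ) ≤
      (β * r + (1 - β) * 4) * a τ + 3 * r / β * h τ := by
    rcases hβ0.eq_or_lt with rfl | hβpos
    · have hε0 : ε = 0 := by simpa using hβε
      have hzero : h =ᵐ[ν] 0 := by
        rw [← integral_eq_zero_iff_of_nonneg_ae hh_nonneg hh_int]
        exact le_antisymm (hε0 ▸ hh_le) (integral_nonneg_of_ae hh_nonneg)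
      filter_upwards [hAC, hap, hzero] with τ hτ hapτ h0
      have haq : a τ ≤ 4 * q τ := by
        by_contra! hlt
        have h1 := le_three_mul_mul_log_div_sub_add (hq_nonneg τ) hτ hlt
        have h2 : a τ * Real.log (a τ / q τ) - a τ + q τ = 0 := h0
        linarith [hq_nonneg τ]
      have := sq_div_mixture_le (ha_nonneg τ) (hp_nonneg τ) (hq_nonneg τ) hr (by norm_num)
        le_rfl hβ1 hapτ haq
      simpa using this
    · filter_upwards [hAC, hap, hh_nonneg] with τ hτ hapτ hnn
      have hnn' : 0 ≤ h τ := hnn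
      rcases le_or_gt (a τ) (4 * q τ) with haq | haq
      · have h1 := sq_div_mixture_le (ha_nonneg τ) (hp_nonneg τ) (hq_nonneg τ) hr (by norm_num)
          hβ0 hβ1 hapτ haq
        have h2 : 0 ≤ 3 * r / β * h τ := by positivity
        linarith
      · have h1 := sq_div_mixture_le_of_pos (ha_nonneg τ) (hp_nonneg τ) (hq_nonneg τ) hr
          hβpos hβ1 hapτ
        have h2 : a τ ≤ 3 * h τ := le_three_mul_mul_log_div_sub_add (hq_nonneg τ) hτ haq
        have h3 : r / β * a τ ≤ r / β * (3 * h τ) :=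
          mul_le_mul_of_nonneg_left h2 (by positivity)
        have h4 : r / β * (3 * h τ) = 3 * r / β * h τ := by ring
        have h5 : 0 ≤ (β * r + (1 - β) * 4) * a τ :=
          mul_nonneg (by positivity) (ha_nonneg τ)
        linarith
  have hB : Integrable (fun τ => (β * r + (1 - β) * 4) * a τ + 3 * r / β * h τ) ν :=
    (ha.const_mul _).add (hh_int.const_mul _)
  have hW : Integrable (fun τ => a τ ^ 2 / (β * p τ + (1 - β) * q τ)) ν := by
    refine hB.mono' (Measurable.aestronglyMeasurable (by fun_prop)) ?_
    filter_upwards [hbound] with τ hτ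
    have hφ : 0 ≤ β * p τ + (1 - β) * q τ :=
      add_nonneg (mul_nonneg hβ0 (hp_nonneg τ)) (mul_nonneg hγ (hq_nonneg τ))
    rwa [Real.norm_of_nonneg (by positivity)]
  refine ⟨hW, (integral_mono_ae hW hB hbound).trans ?_⟩
  rw [integral_add (ha.const_mul _) (hh_int.const_mul _), integral_const_mul, integral_const_mul,
    ha_one]
  have h1 : 3 * r / β * ∫ τ, h τ ∂ν ≤ 3 * r / β * ε :=
    mul_le_mul_of_nonneg_left hh_le (by positivity)
  have h2 : 3 * r / β * ε = 3 * r * β * (2 - ε) := by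
    rcases hβ0.eq_or_lt with rfl | hβpos
    · simp
    · rw [div_mul_eq_mul_div, div_eq_iff hβpos.ne']
      linear_combination 3 * r * hβε
  linarith

/-- Comparison of the two error terms of the variance reduction bound. -/
lemma error_terms_le {Z G ε : ℝ} (hZ : 0 ≤ Z) (hZG : Z ≤ G) (hε0 : 0 ≤ ε) (hε1 : ε ≤ 1) :
    4 * Z ^ 2 * (2 - ε) + 4 * Z * G * ε + 4 * Z * (Z + G) * Real.sqrt (ε * (2 - ε)) ≤
      8 * Z ^ 2 + 4 * Z * (Z + 2 * G) * Real.sqrt ε := by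
  rw [Real.sqrt_mul hε0]
  have hs := Real.sq_sqrt hε0
  have ht := Real.sq_sqrt (show 0 ≤ 2 - ε by linarith)
  have hs0 := Real.sqrt_nonneg ε
  set s := Real.sqrt ε
  set t := Real.sqrt (2 - ε)
  have hst : s + t ≤ 2 := by nlinarith [sq_nonneg (s - t), sq_nonneg (s + t - 2)]
  have ht' : t ≤ 3 / 2 := by nlinarith
  have hkey : 0 ≤ G * (2 - s - t) + Z * (1 + s - t) := by
    nlinarith [mul_le_mul_of_nonneg_right hZG (show 0 ≤ 2 - s - t by linarith),
      mul_nonneg hZ (show 0 ≤ 3 - 2 * t by linarith)]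
  have hprod := mul_nonneg (mul_nonneg hZ hs0) hkey
  rw [← hs]
  nlinarith [hprod]

/-- If `KL(p*‖q̃) ≤ ε` for some `ε ∈ [0,1]`, `G = ess sup_{p>0} ‖g‖ < ∞`
and `∫ p‖g‖² < ∞`, then with `β = √(ε/(2−ε))` and the defensive mixture
`φ = β p + (1−β) q̃` the variance reduction satisfies
`Var_p^on − Var_φ ≥ Var_p[‖g‖] − 4Z²(2−ε) − 4ZGε − 4Z(Z+G)√(ε(2−ε))
                 ≥ Var_p[‖g‖] − 8Z² − 4Z(Z+2G)√ε`,
where `Var_p^on = ∫ p‖g‖² − ‖μ‖²` and `Var_p[‖g‖] = ∫ p‖g‖² − Z²`.  (For `ε = 0` the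
formula gives `β = 0`.) -/
theorem defensive_variance_reduction_eps
    {T : Type*} [MeasurableSpace T] (ν : Measure T) [SigmaFinite ν]
    {d : ℕ} (hd : 1 ≤ d)
    (p : T → ℝ) (g : T → EuclideanSpace ℝ (Fin d))
    (hp_meas : Measurable p) (hp_nonneg : ∀ τ, 0 ≤ p τ)
    (hp_int : Integrable p ν) (hp_one : ∫ τ, p τ ∂ν = 1)
    (hg_meas : Measurable g)
    (hpg_int : Integrable (fun τ => p τ * ‖g τ‖) ν)
    (hpg2_int : Integrable (fun τ => p τ * ‖g τ‖ ^ 2) ν)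
    (Z : ℝ) (hZ : Z = ∫ τ, p τ * ‖g τ‖ ∂ν) (hZ_pos : 0 < Z)
    (μ : EuclideanSpace ℝ (Fin d))
    (hμ_int : Integrable (fun τ => p τ • g τ) ν)
    (hμ : μ = ∫ τ, p τ • g τ ∂ν)
    (pstar : T → ℝ) (hpstar : ∀ τ, pstar τ = p τ * ‖g τ‖ / Z)
    -- a behavioral probability density `q̃`:
    (qt : T → ℝ) (hqt_meas : Measurable qt) (hqt_nonneg : ∀ τ, 0 ≤ qt τ)
    (hqt_int : Integrable qt ν) (hqt_one : ∫ τ, qt τ ∂ν = 1)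
    -- `G = ess sup_{p>0} ‖g‖ < ∞`:
    (G : ℝ) (hG_nonneg : 0 ≤ G)
    (hG : ∀ᵐ τ ∂ν, 0 < p τ → ‖g τ‖ ≤ G)
    -- `KL(p*‖q̃) ≤ ε` for some `ε ∈ [0,1]`:
    (ε : ℝ) (hε : ε ∈ Set.Icc (0 : ℝ) 1)
    (hAC : ∀ᵐ τ ∂ν, qt τ = 0 → pstar τ = 0)
    (hKL_int : IntegrableOn (fun τ => pstar τ * Real.log (pstar τ / qt τ))
      {τ | 0 < pstar τ} ν)
    (hKL_le : (∫ τ in {τ | 0 < pstar τ}, pstar τ * Real.log (pstar τ / qt τ) ∂ν) ≤ ε)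
    -- the defensive parameter `β = √(ε/(2−ε))` and the mixture `φ`:
    (β : ℝ) (hβ : β = Real.sqrt (ε / (2 - ε)))
    (φ : T → ℝ) (hφ : ∀ τ, φ τ = β * p τ + (1 - β) * qt τ) :
    ((∫ τ, p τ * ‖g τ‖ ^ 2 ∂ν) - ‖μ‖ ^ 2)
        - (∫ τ in {τ | 0 < φ τ}, φ τ * ‖(p τ / φ τ) • g τ - μ‖ ^ 2 ∂ν)
      ≥ ((∫ τ, p τ * ‖g τ‖ ^ 2 ∂ν) - Z ^ 2)
          - 4 * Z ^ 2 * (2 - ε) - 4 * Z * G * ε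
          - 4 * Z * (Z + G) * Real.sqrt (ε * (2 - ε)) ∧
    ((∫ τ, p τ * ‖g τ‖ ^ 2 ∂ν) - Z ^ 2)
          - 4 * Z ^ 2 * (2 - ε) - 4 * Z * G * ε
          - 4 * Z * (Z + G) * Real.sqrt (ε * (2 - ε))
      ≥ ((∫ τ, p τ * ‖g τ‖ ^ 2 ∂ν) - Z ^ 2)
          - 8 * Z ^ 2 - 4 * Z * (Z + 2 * G) * Real.sqrt ε := by
  obtain ⟨hε0, hε1⟩ := hε
  have h2ε : 0 < 2 - ε := by linarith
  have hβ0 : 0 ≤ β := hβ ▸ Real.sqrt_nonneg _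
  have hβsq : β ^ 2 = ε / (2 - ε) := by rw [hβ, Real.sq_sqrt (by positivity)]
  have hβε : ε = β ^ 2 * (2 - ε) := by rw [hβsq, div_mul_cancel₀ _ h2ε.ne']
  have hβ1 : β ≤ 1 := by nlinarith
  have hγ : 0 ≤ 1 - β := by linarith
  have hsqrt : Real.sqrt (ε * (2 - ε)) = β * (2 - ε) := by
    rw [Real.sqrt_eq_iff_mul_self_eq (by positivity) (by positivity)]
    linear_combination (2 - ε) * hβε
  have hpgG : ∀ᵐ τ ∂ν, p τ * ‖g τ‖ ≤ G * p τ := by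
    filter_upwards [hG] with τ hτ
    rcases (hp_nonneg τ).eq_or_lt with h0 | hpos
    · simp [← h0]
    · nlinarith [hτ hpos]
  have hZG : Z ≤ G := by
    have h1 := integral_mono_ae hpg_int (hp_int.const_mul G) hpgG
    rwa [integral_const_mul, hp_one, mul_one, ← hZ] at h1
  have herr := error_terms_le hZ_pos.le hZG hε0 hε1
  refine ⟨?_, by linarith⟩
  obtain rfl : pstar = fun τ => p τ * ‖g τ‖ / Z := funext hpstar
  obtain rfl : φ = fun τ => β * p τ + (1 - β) * qt τ := funext hφ
  obtain ⟨hS_int, hS_le⟩ := integral_sq_div_mixture_le (r := G / Z) hp_nonneg hp_meas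
    (fun τ => div_nonneg (mul_nonneg (hp_nonneg τ) (norm_nonneg _)) hZ_pos.le) (by fun_prop)
    (hpg_int.div_const Z) (by rw [integral_div, ← hZ, div_self hZ_pos.ne'])
    hqt_nonneg hqt_meas hqt_int hqt_one (by positivity)
    (by
      filter_upwards [hpgG] with τ hτ
      rw [div_mul_eq_mul_div]
      exact div_le_div_of_nonneg_right hτ hZ_pos.le)
    hAC hKL_int hKL_le hβ0 hβ1 hβε
  have hW_eq : (fun τ => (p τ * ‖g τ‖) ^ 2 / (β * p τ + (1 - β) * qt τ)) =
      fun τ => Z ^ 2 * ((p τ * ‖g τ‖ / Z) ^ 2 / (β * p τ + (1 - β) * qt τ)) := by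
    funext τ
    rw [div_pow, ← mul_div_assoc, mul_div_cancel₀ _ (pow_ne_zero 2 hZ_pos.ne')]
  have hvar := setIntegral_importance_variance (ν := ν) (p := p) (g := g) (μ := μ)
    (φ := fun τ => β * p τ + (1 - β) * qt τ) (by fun_prop)
    (fun τ => add_nonneg (mul_nonneg hβ0 (hp_nonneg τ)) (mul_nonneg hγ (hqt_nonneg τ)))
    ((hp_int.const_mul _).add (hqt_int.const_mul _))
    (by
      rw [integral_add (hp_int.const_mul _) (hqt_int.const_mul _), integral_const_mul,
        integral_const_mul, hp_one, hqt_one]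
      ring)
    hμ_int hμ
    (by
      filter_upwards [hAC] with τ hτ h0
      have hp0 := mul_nonneg hβ0 (hp_nonneg τ)
      have hq0 := mul_nonneg hγ (hqt_nonneg τ)
      have h1 : (1 - β) * qt τ = 0 := by linarith
      have h2 : β * p τ = 0 := by linarith
      rcases mul_eq_zero.1 h1 with h | h
      · have hβ' : β = 1 := by linarith
        simp [show p τ = 0 by simpa [hβ'] using h2]
      · have h3 := hτ h
        rw [div_eq_zero_iff, or_iff_left hZ_pos.ne', mul_eq_zero, norm_eq_zero] at h3
        exact smul_eq_zero.2 h3)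
    (by rw [hW_eq]; exact hS_int.const_mul _)
  rw [hvar, hW_eq, integral_const_mul, hsqrt]
  have hbound := mul_le_mul_of_nonneg_left hS_le (sq_nonneg Z)
  have hexp : Z ^ 2 * (β * (G / Z) + (1 - β) * 4 + 3 * (G / Z) * β * (2 - ε)) =
      Z * G * β + 4 * (1 - β) * Z ^ 2 + 3 * (Z * G) * β * (2 - ε) := by
    field_simp
  rw [hexp] at hbound
  have hGε : 4 * Z * G * ε ≥ 0 := by positivity
  have hZβ : 0 ≤ Z ^ 2 * β := by positivity
  have hZβε : 0 ≤ Z ^ 2 * (β * (2 - ε)) := by positivity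
  have hZGβ : 0 ≤ Z * G * β * (1 - ε) := mul_nonneg (by positivity) (by linarith)
  have hZε : 0 ≤ Z ^ 2 * (1 - ε) := mul_nonneg (by positivity) (by linarith)
  nlinarith [sq_nonneg Z]
end
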